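/- arXiv:2305.02933 — 3 statements merged into one kernel-verified Lean document; each statement's English description precedes it below -/
import Mathlib

section
/- Let g : ℝⁿ → ℝ be any real-valued function and let ẑ ∈ Bₙ be a binary vector. Then there exists λ ∈ ℝⁿ such that for every binary vector z ∈ Bₙ, g(z) ≥ g(ẑ) + ⟨λ, z − ẑ⟩. That is, at every binary point there exists an affine minorant of g on the binary cube that is exact (tight) at that point; this is the tightness property of Lagrangian cuts at binary incumbent solutions. -/
theorem finite_binary_vectors (ι : Type*) [Finite ι] :
    {z : ι → ℝ | ∀ i, z i = 0 ∨ z i = 1}.Finite := by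
  have h : (Set.univ.pi fun _ : ι => ({0, 1} : Set ℝ)).Finite :=
    Set.Finite.pi fun _ => Set.toFinite _
  exact h.subset fun z hz i _ => hz i

/-- Distinct binary vectors have Hamming distance at least one; the distance to `w` is written
as an affine function of `z`. -/
theorem one_le_sum_of_binary_ne {ι : Type*} [Fintype ι] {z w : ι → ℝ}
    (hz : ∀ i, z i = 0 ∨ z i = 1) (hw : ∀ i, w i = 0 ∨ w i = 1) (hne : z ≠ w) :
    1 ≤ ∑ i, (1 - 2 * w i) * (z i - w i) := by
  obtain ⟨j, hj⟩ := Function.ne_iff.mp hne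
  have hnonneg : ∀ i, 0 ≤ (1 - 2 * w i) * (z i - w i) := fun i => by
    rcases hz i with h | h <;> rcases hw i with h' | h' <;> norm_num [h, h']
  have hone : (1 - 2 * w j) * (z j - w j) = 1 := by
    rcases hz j with h | h <;> rcases hw j with h' | h' <;> rw [h, h'] at hj ⊢ <;>
      first | exact absurd rfl hj | norm_num
  exact hone.ge.trans <|
    Finset.single_le_sum (f := fun i => (1 - 2 * w i) * (z i - w i))
      (fun i _ => hnonneg i) (Finset.mem_univ j)

/-- At every binary point there exists an affine minorant of `g` on the binary
cube that is tight at that point (tightness of Lagrangian cuts at binary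
incumbent solutions). -/
theorem exists_tight_affine_minorant_on_binary_cube
    (n : ℕ) (g : (Fin n → ℝ) → ℝ)
    (zhat : Fin n → ℝ) (hzhat : ∀ i, zhat i = 0 ∨ zhat i = 1) :
    ∃ lam : Fin n → ℝ, ∀ z : Fin n → ℝ, (∀ i, z i = 0 ∨ z i = 1) →
      g z ≥ g zhat + ∑ i, lam i * (z i - zhat i) := by
  obtain ⟨M, hM⟩ := ((finite_binary_vectors (Fin n)).image fun z => g zhat - g z).bddAbove
  have hbound : ∀ z : Fin n → ℝ, (∀ i, z i = 0 ∨ z i = 1) → g zhat - g z ≤ M :=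
    fun z hz => hM (Set.mem_image_of_mem _ hz)
  have hM0 : 0 ≤ M := by simpa using hbound zhat hzhat
  refine ⟨fun i => -M * (1 - 2 * zhat i), fun z hz => ?_⟩
  rcases eq_or_ne z zhat with rfl | hne
  · simp
  · have hdist := mul_le_mul_of_nonneg_left (one_le_sum_of_binary_ne hz hzhat hne) hM0
    simp only [mul_assoc, ← Finset.mul_sum]
    linarith [hbound z hz]
end

section
/- Suppose every feasible point has binary state, i.e. ζ(s) ∈ Bₙ for all s ∈ S; suppose ẑ = ζ(s₀) for some s₀ ∈ S; and suppose that for every z′ in the image ζ(S) the set {c(s) : s ∈ S, ζ(s) = z′} is bounded below. Then strong Lagrangian duality holds at ẑ: sup_{λ ∈ ℝⁿ} R(ẑ, λ) = f(ẑ), and the supremum is attained at some λ* ∈ ℝⁿ. (The Lagrangian cut generated at a binary incumbent solution ẑ is tight: its value at ẑ equals the second-stage value function f(ẑ).) -/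
/-- A function is bounded below if it is so on each fiber of a map to binary vectors. -/
theorem exists_lower_bound_of_binary_fibers {n : ℕ} {S : Type*} (c : S → ℝ) (ζ : S → Fin n → ℝ)
    (hbin : ∀ s : S, ∀ i, ζ s i = 0 ∨ ζ s i = 1)
    (hbdd : ∀ z' ∈ Set.range ζ, BddBelow {x : ℝ | ∃ s : S, ζ s = z' ∧ x = c s}) :
    ∃ m : ℝ, ∀ s, m ≤ c s := by
  have hfin : (Set.range ζ).Finite := by
    refine (Set.Finite.pi' (fun _ : Fin n => Set.toFinite ({0, 1} : Set ℝ))).subset ?_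
    rintro _ ⟨s, rfl⟩ i
    exact hbin s i
  obtain ⟨m, hm⟩ := (hfin.bddBelow_biUnion
    (S := fun z' => {x : ℝ | ∃ s : S, ζ s = z' ∧ x = c s})).2 hbdd
  exact ⟨m, fun s => hm (Set.mem_biUnion (Set.mem_range_self s) ⟨s, rfl, rfl⟩)⟩

/-- Strong Lagrangian duality at a binary incumbent solution: if all feasible
states are binary, `ẑ` is attained, and the value function is well defined on
the image of `ζ`, then `sup_λ R(ẑ, λ) = f(ẑ)` and the supremum is attained.  -/
theorem lagrangian_strong_duality_binary
    (n : ℕ) (S : Type*) [Nonempty S] (c : S → ℝ) (ζ : S → Fin n → ℝ)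
    (hbin : ∀ s : S, ∀ i, ζ s i = 0 ∨ ζ s i = 1)
    (zhat : Fin n → ℝ) (s₀ : S) (hzhat : ζ s₀ = zhat)
    (hbdd : ∀ z' ∈ Set.range ζ,
      BddBelow {x : ℝ | ∃ s : S, ζ s = z' ∧ x = c s}) :
    ∃ lamstar : Fin n → ℝ,
      sInf {x : ℝ | ∃ s : S, x = c s + ∑ i, lamstar i * (zhat i - ζ s i)} =
        sInf {x : ℝ | ∃ s : S, ζ s = zhat ∧ x = c s} ∧
      ∀ lam : Fin n → ℝ,
        sInf {x : ℝ | ∃ s : S, x = c s + ∑ i, lam i * (zhat i - ζ s i)} ≤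
          sInf {x : ℝ | ∃ s : S, ζ s = zhat ∧ x = c s} := by
  subst hzhat
  obtain ⟨m, hm⟩ := exists_lower_bound_of_binary_fibers c ζ hbin hbdd
  have hfiber : BddBelow {x : ℝ | ∃ s : S, ζ s = ζ s₀ ∧ x = c s} :=
    hbdd _ (Set.mem_range_self s₀)
  have hweak : ∀ lam : Fin n → ℝ,
      sInf {x : ℝ | ∃ s : S, x = c s + ∑ i, lam i * (ζ s₀ i - ζ s i)} ≤
        sInf {x : ℝ | ∃ s : S, ζ s = ζ s₀ ∧ x = c s} := by
    intro lam
    refine csInf_le_csInf ⟨m + ∑ i, -|lam i|, ?_⟩ ⟨c s₀, s₀, rfl, rfl⟩ ?_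
    · rintro _ ⟨s, rfl⟩
      refine add_le_add (hm s) (Finset.sum_le_sum fun i _ => ?_)
      have h₁ := neg_abs_le (lam i)
      have h₂ := le_abs_self (lam i)
      have h₃ := abs_nonneg (lam i)
      rcases hbin s₀ i with h | h <;> rcases hbin s i with h' | h' <;> rw [h, h'] <;> linarith
    · rintro _ ⟨s, hs, rfl⟩
      exact ⟨s, by simp [hs]⟩
  set f := sInf {x : ℝ | ∃ s : S, ζ s = ζ s₀ ∧ x = c s}
  have hK : 0 ≤ f - m := sub_nonneg.2 <| le_csInf ⟨c s₀, s₀, rfl, rfl⟩ <| by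
    rintro _ ⟨s, -, rfl⟩
    exact hm s
  refine ⟨fun i => (f - m) * (2 * ζ s₀ i - 1),
    le_antisymm (hweak _) (le_csInf ⟨_, s₀, rfl⟩ ?_), hweak⟩
  rintro _ ⟨s, rfl⟩
  by_cases hs : ζ s = ζ s₀
  · have hf : f ≤ c s := csInf_le hfiber ⟨s, hs, rfl⟩
    simpa [hs] using hf
  · obtain ⟨j, hj⟩ := Function.ne_iff.1 hs
    have hnonneg : ∀ i ∈ Finset.univ,
        0 ≤ (f - m) * (2 * ζ s₀ i - 1) * (ζ s₀ i - ζ s i) := by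
      intro i _
      rcases hbin s₀ i with h | h <;> rcases hbin s i with h' | h' <;> rw [h, h'] <;> linarith
    have hterm : (f - m) * (2 * ζ s₀ j - 1) * (ζ s₀ j - ζ s j) = f - m := by
      rcases hbin s₀ j with h | h <;> rcases hbin s j with h' | h' <;> rw [h, h'] at hj ⊢ <;>
        first | exact absurd rfl hj | ring
    have hsum := Finset.single_le_sum hnonneg (Finset.mem_univ j)
    rw [hterm] at hsum
    linarith [hm s]
end

section
/- (Abstract form of the finite-convergence theorem for the Lagrangian-cut decomposition algorithm.) Let X be a nonempty finite set, f : X → ℝ, and let sequences x : ℕ → X (incumbent solutions) and g : ℕ → X → ℝ (cutting-plane approximations) satisfy: (i) validity: g_k(x′) ≤ f(x′) for all k and all x′ ∈ X; (ii) monotonicity: g_k(x′) ≤ g_{k+1}(x′) for all k and x′ (cuts are accumulated, never removed); (iii) master optimality: g_k(x_k) ≤ g_k(x′) for all k and x′; (iv) tight-cut update: g_{k+1}(x_k) = f(x_k) for all k. Then there exists an iteration k ≤ |X| (the cardinality of X) at which g_k(x_k) = f(x_k), and at this iteration x_k is a global minimizer of f over X, i.e. f(x_k) ≤ f(x′) for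 all x′ ∈ X. Hence the algorithm terminates in finitely many iterations with an optimal solution. -/
/-- Abstract finite-convergence theorem for the Lagrangian-cut decomposition
algorithm: under validity, monotonicity, master optimality and the tight-cut
update, within `|X|` iterations the approximation becomes exact at the
incumbent, which is then a global minimizer of `f`. -/
theorem decomposition_finite_convergence
    (X : Type*) [Fintype X] [Nonempty X] (f : X → ℝ)
    (x : ℕ → X) (g : ℕ → X → ℝ)
    (hvalid : ∀ k x', g k x' ≤ f x')
    (hmono : ∀ k x', g k x' ≤ g (k + 1) x')
    (hmaster : ∀ k x', g k (x k) ≤ g k x')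
    (htight : ∀ k, g (k + 1) (x k) = f (x k)) :
    ∃ k ≤ Fintype.card X,
      g k (x k) = f (x k) ∧ ∀ x' : X, f (x k) ≤ f x' := by
  obtain ⟨i, j, hij, hx⟩ : ∃ i j : Fin (Fintype.card X + 1), i < j ∧ x i = x j := by
    obtain ⟨i, j, hne, hx⟩ := Fintype.exists_ne_map_eq_of_card_lt
      (fun i : Fin (Fintype.card X + 1) => x i) (by simp)
    rcases lt_or_gt_of_ne hne with h | h
    · exact ⟨i, j, h, hx⟩
    · exact ⟨j, i, h, hx.symm⟩
  have hle : g (i + 1) (x j) ≤ g j (x j) :=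
    monotone_nat_of_le_succ (f := fun k => g k (x j)) (fun k => hmono k (x j)) hij
  have hexact : g j (x j) = f (x j) := by
    refine le_antisymm (hvalid _ _) ?_
    rwa [← hx, htight, hx] at hle
  exact ⟨j, Nat.lt_succ_iff.mp j.isLt, hexact,
    fun x' => hexact ▸ (hmaster j x').trans (hvalid j x')⟩
end
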